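/- arXiv:2011.05899 — 2 statements merged into one kernel-verified Lean document; each statement's English description precedes it below -/
import Mathlib

section
/- Let Q be a rational function and let f be a meromorphic function on ℂ satisfying S(f) = Q, where S(f) is the Schwarzian derivative of f. If there exists a ∈ ℂ ∪ {∞} such that f has infinitely many a-points on the real axis, then Q is real, that is, Q(conj z) = conj(Q(z)) for all z. -/
open Complex Filter Set Topology

noncomputable section

/-- The open ray emanating from the origin with direction angle `θ`. -/
def Ray (θ : ℝ) : Set ℂ :=
  {z : ℂ | ∃ t : ℝ, 0 < t ∧ z = (t : ℂ) * Complex.exp ((θ : ℂ) * Complex.I)}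

/-- `f` is meromorphic on the open set `U` with pole set `P`. -/
def MeromOn (f : ℂ → ℂ) (P : Set ℂ) (U : Set ℂ) : Prop :=
  P ⊆ U ∧ AnalyticOnNhd ℂ f (U \ P) ∧
    (∀ p ∈ P, Tendsto (fun z => ‖f z‖) (𝓝[≠] p) atTop) ∧
    ∀ z ∈ U, ¬ AccPt z (𝓟 P)

/-- `f` (meromorphic on `ℂ` with pole set `P`) is a rational function. -/
def IsRationalFn (f : ℂ → ℂ) (P : Set ℂ) : Prop :=
  ∃ p q : Polynomial ℂ, q ≠ 0 ∧ ∀ z ∉ P, q.eval z ≠ 0 → f z = p.eval z / q.eval z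

/-- The set of `a`-points of a meromorphic function `f` with pole set `P`, where
`a : Option ℂ` is a point of the Riemann sphere (`Option.none` being `∞`). -/
def aPoints (f : ℂ → ℂ) (P : Set ℂ) : Option ℂ → Set ℂ
  | Option.some a => {z : ℂ | z ∉ P ∧ f z = a}
  | Option.none => P

/-- The Schwarzian derivative `S(f) = (f''/f')' - (1/2) (f''/f')²`. -/
def Schwarzian (f : ℂ → ℂ) (z : ℂ) : ℂ :=
  deriv (fun w => deriv (deriv f) w / deriv f w) z -
    (1 / 2) * (deriv (deriv f) z / deriv f z) ^ 2

theorem ev_punctured {c : ℂ} {p : ℂ → Prop} (h : ∀ᶠ z in 𝓝[≠] c, p z) :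
    ∀ᶠ z in 𝓝[≠] c, ∀ᶠ w in 𝓝 z, p w := by
  filter_upwards [eventually_eventually_nhdsWithin.2 h, self_mem_nhdsWithin] with z hz hzc
  rwa [isOpen_compl_singleton.nhdsWithin_eq hzc] at hz

theorem schwarzian_congr {u v : ℂ → ℂ} {z : ℂ} (h : u =ᶠ[𝓝 z] v) :
    Schwarzian u z = Schwarzian v z := by
  have h1 := h.deriv
  have h2 := h1.deriv
  have h3 : (fun w => deriv (deriv u) w / deriv u w) =ᶠ[𝓝 z]
      (fun w => deriv (deriv v) w / deriv v w) := by
    filter_upwards [h1, h2] with w a b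
    rw [a, b]
  unfold Schwarzian
  rw [h3.deriv_eq, h1.eq_of_nhds, h2.eq_of_nhds]

theorem schwarzian_sub_const (u : ℂ → ℂ) (c z : ℂ) :
    Schwarzian (fun w => u w - c) z = Schwarzian u z := by
  have : deriv (fun w => u w - c) = deriv u := by
    funext w; simp
  unfold Schwarzian
  rw [this]

theorem deriv_inv_eventually {u : ℂ → ℂ} {z : ℂ} (hu : AnalyticAt ℂ u z) (h0 : u z ≠ 0) :
    ∀ᶠ w in 𝓝 z, deriv (fun w => (u w)⁻¹) w = - deriv u w / (u w)^2 := by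
  filter_upwards [hu.eventually_analyticAt, hu.continuousAt.eventually_ne h0] with w h1 h2
  exact (h1.differentiableAt.hasDerivAt.inv h2).deriv

theorem deriv2_inv_eventually {u : ℂ → ℂ} {z : ℂ} (hu : AnalyticAt ℂ u z) (h0 : u z ≠ 0) :
    ∀ᶠ w in 𝓝 z, deriv (deriv (fun w => (u w)⁻¹)) w =
      - deriv (deriv u) w / (u w)^2 + 2 * (deriv u w)^2 / (u w)^3 := by
  filter_upwards [hu.eventually_analyticAt, hu.continuousAt.eventually_ne h0,
    (deriv_inv_eventually hu h0).eventually_nhds] with w h1 h2 h3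
  have h3' : deriv (fun w => (u w)⁻¹) =ᶠ[𝓝 w] fun w => - deriv u w / (u w)^2 := h3
  rw [h3'.deriv_eq]
  have a := h1.deriv.differentiableAt.hasDerivAt
  have b := h1.differentiableAt.hasDerivAt
  have := (a.neg.div (b.pow 2) (pow_ne_zero 2 h2)).deriv
  simp only [Pi.neg_def, Pi.div_def, Pi.pow_def] at this
  rw [this]
  field_simp
  push_cast
  ring

theorem schwarzian_inv {u : ℂ → ℂ} {z : ℂ} (hu : AnalyticAt ℂ u z) (h0 : u z ≠ 0)
    (h1 : deriv u z ≠ 0) : Schwarzian (fun w => (u w)⁻¹) z = Schwarzian u z := by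
  have e : (fun w => deriv (deriv (fun w => (u w)⁻¹)) w / deriv (fun w => (u w)⁻¹) w) =ᶠ[𝓝 z]
      fun w => deriv (deriv u) w / deriv u w - 2 * (deriv u w / u w) := by
    filter_upwards [deriv_inv_eventually hu h0, deriv2_inv_eventually hu h0,
      hu.continuousAt.eventually_ne h0, hu.deriv.continuousAt.eventually_ne h1] with w a b c d
    rw [a, b]
    field_simp
    ring
  have hA := (hu.deriv.deriv.div hu.deriv h1).differentiableAt.hasDerivAt
  have hB := hu.deriv.differentiableAt.hasDerivAt.div hu.differentiableAt.hasDerivAt h0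
  have := (hA.sub (hB.const_mul 2)).deriv
  unfold Schwarzian
  rw [e.deriv_eq, e.eq_of_nhds]
  simp only [Pi.sub_def, Pi.div_def] at this
  rw [this]
  field_simp
  ring

/-- If the Schwarzian stays regular at a point, the derivative does not vanish there. -/
theorem deriv_ne_zero_of_schwarzian {u Q : ℂ → ℂ} {c : ℂ} (hu : AnalyticAt ℂ u c)
    (hnc : ¬ ∀ᶠ z in 𝓝 c, deriv u z = 0) (hQ : ContinuousAt Q c)
    (hS : ∀ᶠ z in 𝓝[≠] c, deriv u z ≠ 0 → Schwarzian u z = Q z) : deriv u c ≠ 0 := by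
  intro hc
  obtain ⟨k, φ, hφ, hφ0, hk⟩ := hu.deriv.exists_eventuallyEq_pow_smul_nonzero_iff.2 hnc
  have hk0 : k ≠ 0 := by
    rintro rfl
    have := hk.self_of_nhds
    simp [hc] at this
    exact hφ0 this.symm
  have key : ∀ᶠ z in 𝓝[≠] c, (z - c)^2 * Q z = -k + (z-c)^2 * deriv (fun w => deriv φ w / φ w) z
      - (1/2) * (k + (z-c) * (deriv φ z / φ z))^2 := by
    have hlog : ∀ᶠ z in 𝓝[≠] c, deriv (deriv u) z / deriv u z
        = k / (z - c) + deriv φ z / φ z := by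
      have e1 : deriv u =ᶠ[𝓝 c] fun z => (z - c)^k • φ z := hk
      filter_upwards [e1.deriv.filter_mono nhdsWithin_le_nhds, hk.filter_mono nhdsWithin_le_nhds,
        hφ.eventually_analyticAt.filter_mono nhdsWithin_le_nhds,
        (hφ.continuousAt.eventually_ne hφ0).filter_mono nhdsWithin_le_nhds,
        self_mem_nhdsWithin] with z h1 h2 h3 h4 h5
      have hzc : z - c ≠ 0 := sub_ne_zero.2 h5
      rw [h1, h2]
      have := ((((hasDerivAt_id z).sub_const c).pow k).mul h3.differentiableAt.hasDerivAt).deriv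
      simp only [Pi.mul_def, Pi.pow_def, id] at this
      simp only [smul_eq_mul]
      rw [this]
      obtain ⟨m, rfl⟩ := Nat.exists_eq_succ_of_ne_zero hk0
      simp only [Nat.succ_eq_add_one, Nat.add_sub_cancel]
      field_simp
      ring
    filter_upwards [ev_punctured hlog, hS, hk.filter_mono nhdsWithin_le_nhds,
        hφ.eventually_analyticAt.filter_mono nhdsWithin_le_nhds,
        (hφ.continuousAt.eventually_ne hφ0).filter_mono nhdsWithin_le_nhds,
        self_mem_nhdsWithin] with z h1 h2 h3 h4 h5 h6
    have hzc : z - c ≠ 0 := sub_ne_zero.2 h6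
    have h1' : (fun z => deriv (deriv u) z / deriv u z) =ᶠ[𝓝 z]
      fun z => k / (z - c) + deriv φ z / φ z := h1
    rw [← h2 (by rw [h3]; exact smul_ne_zero (pow_ne_zero _ hzc) h5)]
    unfold Schwarzian
    rw [h1'.deriv_eq, h1'.eq_of_nhds]
    have hA := (h4.deriv.div h4 h5).differentiableAt.hasDerivAt
    have hB := (hasDerivAt_const z (k:ℂ)).div ((hasDerivAt_id z).sub_const c) hzc
    have := (hB.add hA).deriv
    simp only [Pi.add_def, Pi.div_def, id] at this
    rw [this]
    field_simp
    ring
  have hψ : AnalyticAt ℂ (fun w => deriv φ w / φ w) c := hφ.deriv.div hφ hφ0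
  have hsub : ContinuousAt (fun z : ℂ => z - c) c := by fun_prop
  have t1 : Tendsto (fun z => (z - c)^2 * Q z) (𝓝[≠] c) (𝓝 ((c - c)^2 * Q c)) :=
    (((hsub.pow 2).mul hQ).tendsto).mono_left nhdsWithin_le_nhds
  have t2 : Tendsto (fun z => -k + (z-c)^2 * deriv (fun w => deriv φ w / φ w) z
      - (1/2) * (k + (z-c) * (deriv φ z / φ z))^2) (𝓝[≠] c)
      (𝓝 (-k + (c-c)^2 * deriv (fun w => deriv φ w / φ w) c
      - (1/2) * (k + (c-c) * (deriv φ c / φ c))^2)) := by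
    refine Tendsto.mono_left (ContinuousAt.tendsto ?_) nhdsWithin_le_nhds
    exact (continuousAt_const.add ((hsub.pow 2).mul hψ.deriv.continuousAt)).sub
      (continuousAt_const.mul ((continuousAt_const.add (hsub.mul hψ.continuousAt)).pow 2))
  have := tendsto_nhds_unique (t1.congr' key) t2
  simp only [sub_self, zero_mul, ne_eq, OfNat.ofNat_ne_zero, not_false_eq_true, zero_pow,
    add_zero] at this
  have h2 : ((2 * k + k^2 : ℕ) : ℂ) = 0 := by
    push_cast
    linear_combination 2 * this
  have h3 := Nat.cast_eq_zero.1 h2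
  have : 0 < k := Nat.pos_of_ne_zero hk0
  omega

theorem schwarzian_eq_at {u Q : ℂ → ℂ} {c : ℂ} (hu : AnalyticAt ℂ u c)
    (h1 : deriv u c ≠ 0) (hQ : ContinuousAt Q c)
    (hS : ∀ᶠ z in 𝓝[≠] c, deriv u z ≠ 0 → Schwarzian u z = Q z) : Schwarzian u c = Q c := by
  have hG := hu.deriv.deriv.div hu.deriv h1
  have hc : ContinuousAt (Schwarzian u) c := by
    have : ContinuousAt (fun z => deriv (fun w => deriv (deriv u) w / deriv u w) z -
      (1 / 2) * (deriv (deriv u) z / deriv u z) ^ 2) c :=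
      hG.deriv.continuousAt.sub (continuousAt_const.mul (hG.continuousAt.pow 2))
    exact this
  refine tendsto_nhds_unique (hc.tendsto.mono_left (nhdsWithin_le_nhds (s := {c}ᶜ))) ?_
  refine (hQ.tendsto.mono_left nhdsWithin_le_nhds).congr' ?_
  filter_upwards [hS, (hu.deriv.continuousAt.eventually_ne h1).filter_mono nhdsWithin_le_nhds]
    with z a b
  exact (a b).symm

theorem exists_inv_analytic {f : ℂ → ℂ} {c : ℂ} (hf : ∀ᶠ z in 𝓝[≠] c, AnalyticAt ℂ f z)
    (hp : Tendsto (fun z => ‖f z‖) (𝓝[≠] c) atTop) :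
    ∃ u : ℂ → ℂ, AnalyticAt ℂ u c ∧ u c = 0 ∧ (∀ᶠ z in 𝓝[≠] c, u z = (f z)⁻¹ ∧ f z ≠ 0) := by
  have hne : ∀ᶠ z in 𝓝[≠] c, f z ≠ 0 := by
    filter_upwards [hp.eventually_gt_atTop 0] with z hz
    exact norm_pos_iff.1 hz
  have he : ∀ᶠ z in 𝓝[≠] c, Function.update (fun z => (f z)⁻¹) c 0 z = (f z)⁻¹ := by
    filter_upwards [self_mem_nhdsWithin] with z hz
    exact Function.update_of_ne hz _ _
  refine ⟨Function.update (fun z => (f z)⁻¹) c 0, ?_, by simp, he.and hne⟩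
  apply Complex.analyticAt_of_differentiable_on_punctured_nhds_of_continuousAt
  · filter_upwards [hf, hne, ev_punctured he] with z h1 h2 h3
    have h3' : Function.update (fun z => (f z)⁻¹) c 0 =ᶠ[𝓝 z] fun z => (f z)⁻¹ := h3
    exact h3'.differentiableAt_iff.2 (h1.differentiableAt.inv h2)
  · rw [continuousAt_update_same]
    rw [tendsto_zero_iff_norm_tendsto_zero]
    simp only [norm_inv]
    exact tendsto_inv_atTop_zero.comp hp

theorem eventually_const_of_deriv {u : ℂ → ℂ} {c : ℂ} (hu : AnalyticAt ℂ u c)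
    (h : ∀ᶠ z in 𝓝 c, deriv u z = 0) : ∀ᶠ z in 𝓝 c, u z = u c := by
  obtain ⟨r, hr, hb⟩ := Metric.eventually_nhds_iff_ball.1 (h.and hu.eventually_analyticAt)
  filter_upwards [Metric.ball_mem_nhds c hr] with z hz
  refine Metric.isOpen_ball.is_const_of_deriv_eq_zero (convex_ball c r).isPreconnected
    (fun w hw => (hb w hw).2.differentiableAt.differentiableWithinAt) (fun w hw => (hb w hw).1) hz
    (Metric.mem_ball_self hr)

/-- The Wronskian-type quantity. -/
def Wr (g : ℂ → ℂ) (z : ℂ) : ℝ := (deriv (deriv g) z / deriv g z).im / ‖deriv g z‖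

theorem wr_tendsto {g u Q : ℂ → ℂ} {c : ℂ} (hu : AnalyticAt ℂ u c) (hu0 : u c = 0)
    (hgu : ∀ᶠ z in 𝓝[≠] c, g z = (u z)⁻¹ ∧ u z ≠ 0) (hQ : ContinuousAt Q c)
    (hS : ∀ᶠ z in 𝓝[≠] c, deriv g z ≠ 0 → Schwarzian g z = Q z) :
    Tendsto (Wr g) (𝓝[≠] c) (𝓝 0) := by
  have hnc : ¬ ∀ᶠ z in 𝓝 c, deriv u z = 0 := by
    intro h
    have h1 := (eventually_const_of_deriv hu h).filter_mono (nhdsWithin_le_nhds (s := {c}ᶜ))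
    obtain ⟨z, hz1, hz2⟩ := (h1.and hgu).exists
    exact hz2.2 (hz1.trans hu0)
  have hSu : ∀ᶠ z in 𝓝[≠] c, deriv u z ≠ 0 → Schwarzian u z = Q z := by
    filter_upwards [hS, ev_punctured hgu,
      hu.eventually_analyticAt.filter_mono nhdsWithin_le_nhds] with z h1 h2 h3 h4
    have e : g =ᶠ[𝓝 z] fun w => (u w)⁻¹ := h2.mono fun _ h => h.1
    have h0 := h2.self_of_nhds.2
    rw [← schwarzian_inv h3 h0 h4, ← schwarzian_congr e]
    apply h1
    rw [e.deriv_eq, (deriv_inv_eventually h3 h0).self_of_nhds]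
    exact div_ne_zero (neg_ne_zero.2 h4) (pow_ne_zero 2 h0)
  have hu1 := deriv_ne_zero_of_schwarzian hu hnc hQ hSu
  have hlim : Tendsto (fun z => ‖deriv (deriv u) z‖ * ‖u z‖^2 / ‖deriv u z‖^2 + 2 * ‖u z‖)
      (𝓝[≠] c) (𝓝 0) := by
    have : ContinuousAt
        (fun z => ‖deriv (deriv u) z‖ * ‖u z‖^2 / ‖deriv u z‖^2 + 2 * ‖u z‖) c :=
      ((hu.deriv.deriv.continuousAt.norm.mul (hu.continuousAt.norm.pow 2)).div
        (hu.deriv.continuousAt.norm.pow 2) (pow_ne_zero 2 (norm_ne_zero_iff.2 hu1))).add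
        (continuousAt_const.mul hu.continuousAt.norm)
    have := this.tendsto.mono_left (nhdsWithin_le_nhds (s := {c}ᶜ))
    simpa [hu0] using this
  refine squeeze_zero_norm' ?_ hlim
  filter_upwards [ev_punctured hgu, hu.eventually_analyticAt.filter_mono nhdsWithin_le_nhds,
    (hu.deriv.continuousAt.eventually_ne hu1).filter_mono nhdsWithin_le_nhds] with z h2 h3 h4
  have e : g =ᶠ[𝓝 z] fun w => (u w)⁻¹ := h2.mono fun _ h => h.1
  have h0 := h2.self_of_nhds.2
  unfold Wr
  rw [e.deriv_eq, e.deriv.deriv_eq, (deriv_inv_eventually h3 h0).self_of_nhds,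
    (deriv2_inv_eventually h3 h0).self_of_nhds]
  have e2 : (-deriv (deriv u) z / u z ^ 2 + 2 * deriv u z ^ 2 / u z ^ 3) / (-deriv u z / u z ^ 2)
      = deriv (deriv u) z / deriv u z - 2 * (deriv u z / u z) := by
    field_simp
    ring
  rw [e2, Real.norm_eq_abs, abs_div, abs_norm]
  have p0 : 0 < ‖u z‖ := norm_pos_iff.2 h0
  have p1 : 0 < ‖deriv u z‖ := norm_pos_iff.2 h4
  calc _ ≤ (‖deriv (deriv u) z‖ / ‖deriv u z‖ + 2 * (‖deriv u z‖ / ‖u z‖)) /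
        ‖-deriv u z / u z ^ 2‖ := by
        gcongr
        refine (Complex.abs_im_le_norm _).trans ((norm_sub_le _ _).trans ?_)
        simp
    _ = _ := by
        rw [norm_div, norm_neg, norm_pow]
        field_simp

theorem wr_hasDerivAt {g Q : ℂ → ℂ} {t : ℝ} (hg : AnalyticAt ℂ g t) (h1 : deriv g t ≠ 0)
    (hS : Schwarzian g t = Q t) :
    HasDerivAt (fun s : ℝ => Wr g s) ((Q t).im / ‖deriv g t‖) t := by
  have hv := hg.deriv.differentiableAt.hasDerivAt
  have hG := (hg.deriv.deriv.div hg.deriv h1).differentiableAt.hasDerivAt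
  have im_of : ∀ {e : ℂ → ℂ} {e' : ℂ}, HasDerivAt e e' (t:ℂ) →
      HasDerivAt (fun s : ℝ => (e s).im) e'.im t := by
    intro e e' h
    exact Complex.imCLM.hasFDerivAt.comp_hasDerivAt t h.comp_ofReal
  have hN0 : 0 < (deriv g t).re * (deriv g t).re + (deriv g t).im * (deriv g t).im := by
    have := Complex.normSq_pos.2 h1
    rwa [Complex.normSq_apply] at this
  have hre := hv.real_of_complex
  have him := im_of hv
  have hN := ((hre.mul hre).add (him.mul him)).sqrt hN0.ne'
  have hW := (im_of hG).div hN (Real.sqrt_pos.2 hN0).ne'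
  have hfun : (fun s : ℝ => Wr g s) = fun s : ℝ => (deriv (deriv g) s / deriv g s).im /
      √((deriv g s).re * (deriv g s).re + (deriv g s).im * (deriv g s).im) := by
    funext s
    rw [Wr, Complex.norm_def, Complex.normSq_apply]
  rw [hfun]
  refine hW.congr_deriv ?_
  simp only [Pi.add_def, Pi.mul_def, Pi.div_def]
  rw [Complex.norm_def, Complex.normSq_apply]
  set N := √((deriv g t).re * (deriv g t).re + (deriv g t).im * (deriv g t).im) with hNdef
  have hNpos : 0 < N := Real.sqrt_pos.2 hN0
  have hNsq : N^2 = (deriv g t).re * (deriv g t).re + (deriv g t).im * (deriv g t).im :=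
    Real.sq_sqrt hN0.le
  have hG' : deriv (fun w => deriv (deriv g) w / deriv g w) (t:ℂ) =
      Q t + (1/2) * (deriv (deriv g) t / deriv g t)^2 := by
    rw [← hS, Schwarzian]; ring
  rw [hG']
  have hmul : deriv (deriv g) t = (deriv (deriv g) t / deriv g t) * deriv g t := by
    field_simp
  set G := deriv (deriv g) t / deriv g t with hGdef
  rw [hmul]
  generalize deriv g (t:ℂ) = v at *
  have e1 : (Q t + (1/2) * G^2).im = (Q t).im + G.re * G.im := by
    simp [pow_two]
    ring
  rw [e1, Complex.mul_re, Complex.mul_im]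
  field_simp
  rw [hNsq]
  ring

theorem ofReal_tendsto_gt (x : ℝ) : Tendsto (fun t : ℝ => (t : ℂ)) (𝓝[>] x) (𝓝[≠] (x:ℂ)) := by
  refine tendsto_nhdsWithin_iff.2 ⟨(Complex.continuous_ofReal.tendsto x).mono_left
    nhdsWithin_le_nhds, ?_⟩
  filter_upwards [self_mem_nhdsWithin] with t ht
  simpa using (ne_of_gt ht)

theorem ofReal_tendsto_lt (x : ℝ) : Tendsto (fun t : ℝ => (t : ℂ)) (𝓝[<] x) (𝓝[≠] (x:ℂ)) := by
  refine tendsto_nhdsWithin_iff.2 ⟨(Complex.continuous_ofReal.tendsto x).mono_left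
    nhdsWithin_le_nhds, ?_⟩
  filter_upwards [self_mem_nhdsWithin] with t ht
  simpa using (ne_of_lt ht)

theorem exists_im_zero {g Q : ℂ → ℂ} {x y : ℝ} (hxy : x < y)
    (hg : ∀ t ∈ Ioo x y, AnalyticAt ℂ g (t:ℂ))
    (hQ : ∀ t ∈ Icc x y, ContinuousAt Q (t:ℂ))
    (hS : ∀ t ∈ Icc x y, ∀ᶠ z in 𝓝[≠] (t:ℂ), deriv g z ≠ 0 → Schwarzian g z = Q z)
    (hx : ∃ u : ℂ → ℂ, AnalyticAt ℂ u x ∧ u x = 0 ∧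
      ∀ᶠ z in 𝓝[≠] (x:ℂ), g z = (u z)⁻¹ ∧ u z ≠ 0)
    (hy : ∃ u : ℂ → ℂ, AnalyticAt ℂ u y ∧ u y = 0 ∧
      ∀ᶠ z in 𝓝[≠] (y:ℂ), g z = (u z)⁻¹ ∧ u z ≠ 0) :
    ∃ t ∈ Ioo x y, (Q t).im = 0 := by
  obtain ⟨u, hu, hu0, hgu⟩ := hx
  obtain ⟨v, hv, hv0, hgv⟩ := hy
  have hnc : ∀ t ∈ Ioo x y, ¬ ∀ᶠ z in 𝓝 (t:ℂ), deriv g z = 0 := by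
    intro t ht h
    have h1 := eventually_const_of_deriv (hg t ht) h
    have hA : AnalyticOnNhd ℂ g ((fun s : ℝ => (s:ℂ)) '' Ioo x y) := by
      rintro _ ⟨s, hs, rfl⟩
      exact hg s hs
    have hpre : IsPreconnected ((fun s : ℝ => (s:ℂ)) '' Ioo x y) :=
      isPreconnected_Ioo.image _ Complex.continuous_ofReal.continuousOn
    have heq := hA.eqOn_of_preconnected_of_eventuallyEq (g := fun _ => g t)
      (fun _ _ => analyticAt_const) hpre (mem_image_of_mem _ ht) h1
    have l1 : Tendsto (fun s : ℝ => u s * g t) (𝓝[>] x) (𝓝 (0 * g t)) := by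
      have := ((hu.continuousAt.tendsto.mono_left
        (nhdsWithin_le_nhds (s := {(x:ℂ)}ᶜ))).comp (ofReal_tendsto_gt x)).mul_const (g t)
      rw [hu0] at this
      exact this
    have l2 : Tendsto (fun s : ℝ => u s * g t) (𝓝[>] x) (𝓝 1) := by
      refine tendsto_const_nhds.congr' ?_
      filter_upwards [(ofReal_tendsto_gt x).eventually hgu, Ioo_mem_nhdsGT hxy] with s hs1 hs2
      have := heq (mem_image_of_mem _ hs2)
      simp only at this
      rw [← this, hs1.1, mul_inv_cancel₀ hs1.2]
    have := tendsto_nhds_unique l1 l2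
    simp at this
  have hd : ∀ t ∈ Ioo x y, deriv g (t:ℂ) ≠ 0 := fun t ht =>
    deriv_ne_zero_of_schwarzian (hg t ht) (hnc t ht) (hQ t (Ioo_subset_Icc_self ht))
      (hS t (Ioo_subset_Icc_self ht))
  obtain ⟨t, ht, h⟩ := exists_hasDerivAt_eq_zero' (f := fun s : ℝ => Wr g s)
    (f' := fun t : ℝ => (Q t).im / ‖deriv g t‖) hxy
    ((wr_tendsto hu hu0 hgu (hQ x (left_mem_Icc.2 hxy.le)) (hS x (left_mem_Icc.2 hxy.le))).comp
      (ofReal_tendsto_gt x))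
    ((wr_tendsto hv hv0 hgv (hQ y (right_mem_Icc.2 hxy.le)) (hS y (right_mem_Icc.2 hxy.le))).comp
      (ofReal_tendsto_lt y))
    (fun t ht => wr_hasDerivAt (hg t ht) (hd t ht) (schwarzian_eq_at (hg t ht) (hd t ht)
      (hQ t (Ioo_subset_Icc_self ht)) (hS t (Ioo_subset_Icc_self ht))))
  refine ⟨t, ht, ?_⟩
  rcases div_eq_zero_iff.1 h with h | h
  · exact h
  · exact absurd (norm_eq_zero.1 h) (hd t ht)

theorem meromOn_punctured {f : ℂ → ℂ} {P : Set ℂ} (hf : MeromOn f P Set.univ) (t : ℂ) :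
    ∀ᶠ z in 𝓝[≠] t, z ∉ P ∧ AnalyticAt ℂ f z := by
  have h := hf.2.2.2 t (mem_univ t)
  rw [accPt_iff_frequently_nhdsNE, not_frequently] at h
  filter_upwards [h] with z hz
  exact ⟨hz, hf.2.1 z ⟨mem_univ _, hz⟩⟩

theorem meromOn_nhds {f : ℂ → ℂ} {P : Set ℂ} (hf : MeromOn f P Set.univ) {t : ℂ} (ht : t ∉ P) :
    ∀ᶠ z in 𝓝 t, z ∉ P := by
  have h := meromOn_punctured hf t
  rw [eventually_nhdsWithin_iff] at h
  filter_upwards [h] with z hz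
  by_cases e : z = t
  · rwa [e]
  · exact (hz e).1

theorem meromOn_meromorphicAt {f : ℂ → ℂ} {P : Set ℂ} (hf : MeromOn f P Set.univ) (t : ℂ) :
    MeromorphicAt f t := by
  by_cases ht : t ∈ P
  · obtain ⟨u, hu, -, h⟩ := exists_inv_analytic ((meromOn_punctured hf t).mono fun _ h => h.2)
      (hf.2.2.1 t ht)
    refine hu.meromorphicAt.inv.congr ?_
    filter_upwards [h] with z hz
    simp [hz.1]
  · exact (hf.2.1 t ⟨mem_univ _, ht⟩).meromorphicAt

theorem meromOn_ne {f : ℂ → ℂ} {P : Set ℂ} (hf : MeromOn f P Set.univ)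
    (hnc : ∃ z : ℂ, z ∉ P ∧ deriv f z ≠ 0) (a t : ℂ) : ∀ᶠ z in 𝓝[≠] t, f z - a ≠ 0 := by
  have hm : MeromorphicOn (fun z => f z - a) Set.univ := fun z _ =>
    (meromOn_meromorphicAt hf z).sub (MeromorphicAt.const a z)
  obtain ⟨z₀, hz₀, hd⟩ := hnc
  have h1 : meromorphicOrderAt (fun z => f z - a) z₀ ≠ ⊤ := by
    intro h
    rw [meromorphicOrderAt_eq_top_iff] at h
    have hA := hf.2.1 z₀ ⟨mem_univ _, hz₀⟩
    have h2 : ∀ᶠ z in 𝓝[≠] z₀, deriv f z = 0 := by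
      filter_upwards [ev_punctured h] with z hz
      have : f =ᶠ[𝓝 z] fun _ => a := hz.mono fun w hw => sub_eq_zero.1 hw
      rw [this.deriv_eq]
      simp
    obtain ⟨z, h3, h4⟩ := (h2.and
      ((hA.deriv.continuousAt.eventually_ne hd).filter_mono nhdsWithin_le_nhds)).exists
    exact h4 h3
  have h2 := (hm.exists_meromorphicOrderAt_ne_top_iff_forall isConnected_univ).1
    ⟨⟨z₀, mem_univ _⟩, h1⟩ ⟨t, mem_univ _⟩
  rcases (hm t (mem_univ t)).eventually_eq_zero_or_eventually_ne_zero with h | h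
  · exact absurd (meromorphicOrderAt_eq_top_iff.2 h) h2
  · exact h

/-- Two consecutive points of an infinite locally finite set, with no bad point between. -/
theorem exists_consecutive {A : Set ℂ} (hA : ∀ t, ¬ AccPt t (𝓟 A))
    (hinf : {z ∈ A | z.im = 0}.Infinite) {B : Set ℝ} (hB : B.Finite) :
    ∃ x y : ℝ, x < y ∧ (x:ℂ) ∈ A ∧ (y:ℂ) ∈ A ∧ (∀ t ∈ Ioo x y, (t:ℂ) ∉ A) ∧
      ∀ t ∈ Icc x y, t ∉ B := by
  have hR : {t : ℝ | (t:ℂ) ∈ A}.Infinite := by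
    intro hfin
    refine hinf ((hfin.image (fun t : ℝ => (t:ℂ))).subset ?_)
    rintro z ⟨hz, hi⟩
    have e : ((z.re : ℝ) : ℂ) = z := Complex.ext (by simp) (by simp [hi])
    exact ⟨z.re, by simpa [e] using hz, e⟩
  have hR' := hR.diff hB
  have : ∃ x y : ℝ, x < y ∧ (x:ℂ) ∈ A ∧ (y:ℂ) ∈ A ∧ ∀ t ∈ Icc x y, t ∉ B := by
    obtain ⟨x, hx, y, hy, hne, he⟩ := hR'.exists_ne_map_eq_of_mapsTo
      (f := fun x => {b ∈ B | b < x}) (t := B.powerset) (fun x _ b hb => hb.1) hB.finite_subsets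
    have key : ∀ x y : ℝ, x < y → x ∈ {t : ℝ | (t:ℂ) ∈ A} \ B → y ∈ {t : ℝ | (t:ℂ) ∈ A} \ B →
        {b ∈ B | b < x} = {b ∈ B | b < y} →
        ∃ x y : ℝ, x < y ∧ (x:ℂ) ∈ A ∧ (y:ℂ) ∈ A ∧ ∀ t ∈ Icc x y, t ∉ B := by
      intro x y hxy hx hy he
      refine ⟨x, y, hxy, hx.1, hy.1, fun t ht htB => ?_⟩
      have hty : t < y := lt_of_le_of_ne ht.2 (fun h => hy.2 (h ▸ htB))
      have : t ∈ {b ∈ B | b < x} := he ▸ ⟨htB, hty⟩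
      exact absurd this.2 (not_lt.2 ht.1)
    rcases lt_or_gt_of_ne hne with h | h
    · exact key x y h hx hy he
    · exact key y x h hy hx he.symm
  obtain ⟨x, y, hxy, hx, hy, hb⟩ := this
  have hfin : {t : ℝ | t ∈ Ioc x y ∧ (t:ℂ) ∈ A}.Finite := by
    by_contra hi
    have hi2 : ((fun t : ℝ => (t:ℂ)) '' {t : ℝ | t ∈ Ioc x y ∧ (t:ℂ) ∈ A}).Infinite :=
      Set.Infinite.image Complex.ofReal_injective.injOn hi
    obtain ⟨c, -, hc⟩ := hi2.exists_accPt_of_subset_isCompact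
      ((isCompact_Icc (a := x) (b := y)).image Complex.continuous_ofReal)
      (image_mono fun t ht => Ioc_subset_Icc_self ht.1)
    refine hA c (hc.mono (principal_mono.2 ?_))
    rintro _ ⟨t, ht, rfl⟩
    exact ht.2
  obtain ⟨m, hm, hmin⟩ := hfin.exists_minimal ⟨y, ⟨hxy, le_rfl⟩, hy⟩
  refine ⟨x, m, hm.1.1, hx, hm.2, fun t ht htA => ?_, fun t ht => hb t ⟨ht.1, ht.2.trans hm.1.2⟩⟩
  exact absurd (hmin ⟨⟨ht.1, ht.2.le.trans hm.1.2⟩, htA⟩ ht.2.le) (not_le.2 ht.2)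

/-- **Lemma 8.** Let `Q = p/q` be a rational function and let `f` be a (nonconstant)
meromorphic function on `ℂ` with `S(f) = Q`. If `f` has infinitely many `a`-points on the real
axis for some value `a` on the Riemann sphere, then `Q` is real, i.e.
`Q(conj z) = conj (Q z)` wherever defined. -/
theorem rational_schwarzian_real_of_infinitely_many_real_a_points
    (f : ℂ → ℂ) (P : Set ℂ) (hf : MeromOn f P Set.univ)
    (hnc : ∃ z : ℂ, z ∉ P ∧ deriv f z ≠ 0)
    (p q : Polynomial ℂ) (hq : q ≠ 0)
    (hschw : ∀ z : ℂ, z ∉ P → deriv f z ≠ 0 → q.eval z ≠ 0 →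
      Schwarzian f z = p.eval z / q.eval z)
    (a : Option ℂ) (hinf : {z ∈ aPoints f P a | z.im = 0}.Infinite) :
    ∀ z : ℂ, q.eval z ≠ 0 → q.eval ((starRingEnd ℂ) z) ≠ 0 →
      p.eval ((starRingEnd ℂ) z) / q.eval ((starRingEnd ℂ) z) =
        (starRingEnd ℂ) (p.eval z / q.eval z) := by
  classical
  by_cases hR : p * q.map (starRingEnd ℂ) - p.map (starRingEnd ℂ) * q = 0
  · intro z h1 h2
    have h3 : (starRingEnd ℂ) (q.eval z) ≠ 0 := by simpa using h1
    rw [map_div₀, div_eq_div_iff h2 h3]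
    have := congrArg (Polynomial.eval ((starRingEnd ℂ) z)) hR
    simp only [Polynomial.eval_sub, Polynomial.eval_mul, Polynomial.eval_map_apply,
      Polynomial.eval_zero] at this
    linear_combination this
  exfalso
  set R := p * q.map (starRingEnd ℂ) - p.map (starRingEnd ℂ) * q with hRdef
  set Q : ℂ → ℂ := fun z => p.eval z / q.eval z with hQdef
  have hB : {t : ℝ | q.eval (t:ℂ) = 0 ∨ R.eval (t:ℂ) = 0}.Finite := by
    have : ((q * R).rootSet ℂ).Finite := Polynomial.rootSet_finite _ _
    refine (this.preimage Complex.ofReal_injective.injOn).subset ?_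
    intro t ht
    simp only [mem_preimage, Polynomial.mem_rootSet, Polynomial.coe_aeval_eq_eval,
      Polynomial.eval_mul, mul_eq_zero]
    exact ⟨by simpa using ⟨hq, hR⟩, ht⟩
  have hacc : ∀ t, ¬ AccPt t (𝓟 (aPoints f P a)) := by
    intro t
    cases a with
    | none => exact hf.2.2.2 t (mem_univ t)
    | some a =>
      rw [accPt_iff_frequently_nhdsNE, not_frequently]
      filter_upwards [meromOn_ne hf hnc a t] with z hz h
      exact hz (sub_eq_zero.2 h.2)
  obtain ⟨x, y, hxy, hx, hy, hno, hbad⟩ := exists_consecutive hacc hinf hB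
  have hqne : ∀ t ∈ Icc x y, q.eval (t:ℂ) ≠ 0 := fun t ht h => hbad t ht (Or.inl h)
  have hQc : ∀ t ∈ Icc x y, ContinuousAt Q (t:ℂ) := fun t ht =>
    p.continuous.continuousAt.div q.continuous.continuousAt (hqne t ht)
  have hSf : ∀ t ∈ Icc x y, ∀ᶠ z in 𝓝[≠] (t:ℂ), deriv f z ≠ 0 → Schwarzian f z = Q z := by
    intro t ht
    filter_upwards [meromOn_punctured hf t,
      (q.continuous.continuousAt.eventually_ne (hqne t ht)).filter_mono nhdsWithin_le_nhds]
      with z h1 h2 h3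
    exact hschw z h1.1 h3 h2
  have hpole : ∀ t ∈ P, ∃ u : ℂ → ℂ, AnalyticAt ℂ u t ∧ u t = 0 ∧
      ∀ᶠ z in 𝓝[≠] t, f z = (u z)⁻¹ ∧ u z ≠ 0 := by
    intro t ht
    obtain ⟨u, hu, hu0, h⟩ := exists_inv_analytic ((meromOn_punctured hf t).mono fun _ h => h.2)
      (hf.2.2.1 t ht)
    refine ⟨u, hu, hu0, h.mono fun z hz => ⟨by simp [hz.1], by simp [hz.1, hz.2]⟩⟩
  have main : ∃ t ∈ Ioo x y, (Q t).im = 0 := by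
    cases a with
    | none =>
      exact exists_im_zero hxy (fun t ht => hf.2.1 t ⟨mem_univ _, hno t ht⟩) hQc hSf
        (hpole x hx) (hpole y hy)
    | some a =>
      set g : ℂ → ℂ := fun z => if z ∈ P then 0 else (f z - a)⁻¹ with hgdef
      have hgp : ∀ t : ℂ, ∀ᶠ z in 𝓝[≠] t, g z = (f z - a)⁻¹ ∧ f z - a ≠ 0 := by
        intro t
        filter_upwards [meromOn_punctured hf t, meromOn_ne hf hnc a t] with z h1 h2
        exact ⟨if_neg h1.1, h2⟩
      have hend : ∀ t ∈ aPoints f P (some a), ∃ u : ℂ → ℂ, AnalyticAt ℂ u t ∧ u t = 0 ∧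
          ∀ᶠ z in 𝓝[≠] t, g z = (u z)⁻¹ ∧ u z ≠ 0 := fun t ht =>
        ⟨fun z => f z - a, (hf.2.1 t ⟨mem_univ _, ht.1⟩).sub analyticAt_const,
          sub_eq_zero.2 ht.2, hgp t⟩
      refine exists_im_zero (g := g) hxy ?_ hQc ?_ (hend x hx) (hend y hy)
      · intro t ht
        by_cases htP : (t:ℂ) ∈ P
        · obtain ⟨u, hu, hu0, h⟩ := hpole t htP
          have e : g =ᶠ[𝓝 (t:ℂ)] fun z => u z / (1 - a * u z) := by
            apply eventuallyEq_nhds_of_eventuallyEq_nhdsNE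
            · filter_upwards [hgp t, h] with z h1 h2
              rw [h1.1, h2.1]
              have h3 := h1.2
              rw [h2.1] at h3
              have h4 := h2.2
              have h5 : (u z)⁻¹ - a = (1 - a * u z) / u z := by
                field_simp
              rw [h5, inv_div]
            · simp [hgdef, htP, hu0]
          refine AnalyticAt.congr ?_ e.symm
          exact hu.div (analyticAt_const.sub (analyticAt_const.mul hu)) (by simp [hu0])
        · have hfa : f t - a ≠ 0 := fun h => hno t ht ⟨htP, sub_eq_zero.1 h⟩
          have e : (fun z => (f z - a)⁻¹) =ᶠ[𝓝 (t:ℂ)] g := by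
            filter_upwards [meromOn_nhds hf htP] with z hz
            exact (if_neg hz).symm
          exact (((hf.2.1 t ⟨mem_univ _, htP⟩).sub analyticAt_const).inv hfa).congr e
      · intro t ht
        filter_upwards [hSf t ht, ev_punctured (hgp t), meromOn_punctured hf t]
          with z h1 h2 h3 h4
        have e : g =ᶠ[𝓝 z] fun w => (f w - a)⁻¹ := h2.mono fun _ h => h.1
        have h0 := h2.self_of_nhds.2
        have hA : AnalyticAt ℂ (fun w => f w - a) z := h3.2.sub analyticAt_const
        rw [e.deriv_eq, (deriv_inv_eventually hA h0).self_of_nhds] at h4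
        have h5 : deriv (fun w => f w - a) z ≠ 0 := by
          intro h
          rw [h] at h4
          simp at h4
        rw [schwarzian_congr e, schwarzian_inv hA h0 h5, schwarzian_sub_const]
        apply h1
        simpa using h5
  obtain ⟨t, ht, him⟩ := main
  have htI := Ioo_subset_Icc_self ht
  apply hbad t htI
  right
  have hconj : (starRingEnd ℂ) (Q t) = Q t := Complex.conj_eq_iff_im.2 him
  have hq0 := hqne t htI
  have hq1 : (starRingEnd ℂ) (q.eval (t:ℂ)) ≠ 0 := by simpa using hq0
  rw [hQdef] at hconj
  simp only [map_div₀] at hconj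
  rw [div_eq_div_iff hq1 hq0] at hconj
  have hev : ∀ s : Polynomial ℂ, (s.map (starRingEnd ℂ)).eval (t:ℂ) =
      (starRingEnd ℂ) (s.eval (t:ℂ)) := by
    intro s
    have := Polynomial.eval_map_apply (p := s) (starRingEnd ℂ) (t:ℂ)
    rwa [Complex.conj_ofReal] at this
  rw [hRdef, Polynomial.eval_sub, Polynomial.eval_mul, Polynomial.eval_mul, hev, hev]
  linear_combination -hconj
end
end

section
/- Let u be a positive harmonic function in the right half-plane {z ∈ ℂ : Re z > 0} which extends continuously to the punctured imaginary axis iℝ \ {0} with u(iy) = 0 for all y ∈ ℝ \ {0}. Then there exist constants a, b ≥ 0 such that u(z) = Re(a z + b/z) for all z with Re z > 0. -/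
open Complex Filter Set Topology

namespace HalfPlaneAux

/-- The Cayley map from the unit disc to the right half-plane. -/
noncomputable def cay (w : ℂ) : ℂ := (1 + w) / (1 - w)

lemma cay_re (w : ℂ) : (cay w).re = (1 - ‖w‖ ^ 2) / ‖1 - w‖ ^ 2 := by
  rw [cay, div_re, ← add_div, ← normSq_eq_norm_sq, ← normSq_eq_norm_sq]
  congr 1
  simp [normSq_apply]
  ring

lemma cay_re_pos {w : ℂ} (hw : ‖w‖ < 1) : 0 < (cay w).re := by
  have h : 1 - w ≠ 0 := by
    intro h
    have : w = 1 := by linear_combination -h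
    simp [this] at hw
  rw [cay_re]
  have := norm_pos_iff.2 h
  have := norm_nonneg w
  apply div_pos (by nlinarith) (by positivity)

lemma harm_of_hyp (u : ℂ → ℝ)
    (hreg : ContDiffOn ℝ 2 u {z : ℂ | 0 < z.re})
    (hharm : ∀ z ∈ {z : ℂ | 0 < z.re},
      fderiv ℝ (fun w : ℂ => fderiv ℝ u w 1) z 1 +
        fderiv ℝ (fun w : ℂ => fderiv ℝ u w Complex.I) z Complex.I = 0) :
    ∀ z : ℂ, 0 < z.re → InnerProductSpace.HarmonicAt u z := by
  have ho : IsOpen {z : ℂ | 0 < z.re} := isOpen_lt continuous_const continuous_re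
  intro z hz
  refine ⟨hreg.contDiffAt (ho.mem_nhds hz), ?_⟩
  filter_upwards [ho.mem_nhds hz] with x hx
  have hc : ContDiffAt ℝ 2 u x := hreg.contDiffAt (ho.mem_nhds hx)
  have hd : DifferentiableAt ℝ (fderiv ℝ u) x := by fun_prop
  have h := hharm x hx
  rw [fderiv_clm_apply hd (by fun_prop), fderiv_clm_apply hd (by fun_prop)] at h
  rw [InnerProductSpace.laplacian_eq_iteratedFDeriv_complexPlane]
  simpa [iteratedFDeriv_two_apply] using h

lemma harm_comp {u : ℂ → ℝ} {g : ℂ → ℂ} {w : ℂ}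
    (hu : InnerProductSpace.HarmonicAt u (g w)) (hg : AnalyticAt ℂ g w) :
    InnerProductSpace.HarmonicAt (fun x => u (g x)) w := by
  obtain ⟨ε, h₁ε, h₂ε⟩ := Metric.isOpen_iff.1
    (InnerProductSpace.isOpen_setOfPred_harmonicAt (f := u)) (g w) hu
  obtain ⟨F, h₁F, h₂F⟩ := InnerProductSpace.HarmonicOnNhd.exists_analyticOnNhd_ball_re_eq
    (fun _ hy ↦ h₂ε hy)
  have hF : AnalyticAt ℂ (fun x => F (g x)) w :=
    (h₁F (g w) (Metric.mem_ball_self h₁ε)).fun_comp hg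
  refine (InnerProductSpace.harmonicAt_congr_nhds ?_).1 hF.harmonicAt_re
  filter_upwards [hg.continuousAt (Metric.ball_mem_nhds _ h₁ε)] with x hx
  exact h₂F hx

/-- Functions vanishing at `±1` do not see the mass in the limit. -/
lemma decay {ι : Type*} {l : Filter ι} (V : ι → ℂ → ℝ) (c : ℝ) (E : ℂ → ℝ)
    (hV0 : ∀ i, ∀ ζ ∈ Metric.sphere (0 : ℂ) 1, 0 ≤ V i ζ)
    (hVc : ∀ i, ContinuousOn (V i) (Metric.sphere 0 1))
    (hVm : ∀ i, Real.circleAverage (V i) 0 1 = c)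
    (hE : ContinuousOn E (Metric.sphere 0 1)) (hE1 : E 1 = 0) (hE2 : E (-1) = 0)
    (hV : ∀ K ⊆ Metric.sphere (0 : ℂ) 1, IsCompact K → 1 ∉ K → -1 ∉ K → ∀ ε > 0,
      ∀ᶠ i in l, ∀ ζ ∈ K, V i ζ < ε) :
    Tendsto (fun i => Real.circleAverage (fun ζ => E ζ * V i ζ) 0 1) l (𝓝 0) := by
  have hS : IsCompact (Metric.sphere (0 : ℂ) 1) := isCompact_sphere 0 1
  obtain ⟨M, hM⟩ := hS.exists_bound_of_continuousOn hE
  have hM0 : 0 ≤ M := (norm_nonneg _).trans (hM 1 (by simp))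
  rw [Metric.tendsto_nhds]
  intro ε hε
  have hc : 0 ≤ c ∨ IsEmpty ι := by
    rcases isEmpty_or_nonempty ι with h | ⟨⟨i⟩⟩
    · exact Or.inr h
    · left
      rw [← hVm i]
      exact Real.circleAverage_nonneg_of_nonneg (by simpa using hV0 i)
  rcases hc with hc | h
  swap
  · exact Eventually.of_forall (fun i => (h.false i).elim)
  set η := ε / (2 * (c + 1)) with hη
  have hη0 : 0 < η := by positivity
  set δ := ε / (2 * (M + 1)) with hδ
  have hδ0 : 0 < δ := by positivity
  let K : Set ℂ := Metric.sphere (0 : ℂ) 1 ∩ (fun ζ => |E ζ|) ⁻¹' (Ici η)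
  have hKc : IsCompact K :=
    hS.of_isClosed_subset ((hE.abs).preimage_isClosed_of_isClosed hS.isClosed isClosed_Ici)
      inter_subset_left
  have h1 : (1 : ℂ) ∉ K := by
    rintro ⟨-, h⟩
    simp [hE1] at h
    linarith
  have h2 : (-1 : ℂ) ∉ K := by
    rintro ⟨-, h⟩
    simp [hE2] at h
    linarith
  filter_upwards [hV K inter_subset_left hKc h1 h2 δ hδ0] with i hi
  have hci : CircleIntegrable (V i) 0 1 := (hVc i).circleIntegrable zero_le_one
  have hEV : ContinuousOn (fun ζ => E ζ * V i ζ) (Metric.sphere 0 1) := hE.mul (hVc i)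
  have hle : Real.circleAverage |fun ζ => E ζ * V i ζ| 0 1 ≤
      Real.circleAverage (fun ζ => η • V i ζ + M * δ) 0 1 := by
    apply Real.circleAverage_mono
    · exact (hEV.abs).circleIntegrable zero_le_one
    · apply ContinuousOn.circleIntegrable zero_le_one
      exact ((hVc i).const_smul η).add continuousOn_const
    · intro ζ hζ
      rw [abs_one] at hζ
      have hv := hV0 i ζ hζ
      have hm : |E ζ| ≤ M := hM ζ hζ
      simp only [Pi.abs_apply, abs_mul, abs_of_nonneg hv, smul_eq_mul]
      by_cases hk : η ≤ |E ζ|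
      · have := hi ζ ⟨hζ, hk⟩
        have : |E ζ| * V i ζ ≤ M * δ := mul_le_mul hm this.le hv hM0
        have : 0 ≤ η * V i ζ := by positivity
        linarith
      · have : |E ζ| * V i ζ ≤ η * V i ζ := mul_le_mul_of_nonneg_right (not_le.1 hk).le hv
        have : 0 ≤ M * δ := by positivity
        linarith
  have heq : Real.circleAverage (fun ζ => η • V i ζ + M * δ) 0 1 = η * c + M * δ := by
    rw [Real.circleAverage_fun_add (f₁ := fun ζ => η • V i ζ) (((hVc i).const_smul η).circleIntegrable zero_le_one)
      (continuousOn_const.circleIntegrable zero_le_one), Real.circleAverage_fun_smul, hVm,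
      Real.circleAverage_const, smul_eq_mul]
  rw [Real.dist_eq, sub_zero]
  have h3 : η * c < ε / 2 := by
    rw [hη, div_mul_eq_mul_div, div_lt_div_iff₀ (by positivity) (by positivity)]
    nlinarith
  have h4 : M * δ < ε / 2 := by
    rw [hδ, mul_div_assoc', div_lt_div_iff₀ (by positivity) (by positivity)]
    nlinarith
  have := Real.abs_circleAverage_le_circleAverage_abs (f := fun ζ => E ζ * V i ζ) (c := 0) (R := 1)
  linarith

lemma bdry_tendsto {u : ℂ → ℝ}
    (hbdry : ∀ y : ℝ, y ≠ 0 →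
      Tendsto u (𝓝[{z : ℂ | 0 < z.re}] ((y : ℂ) * Complex.I)) (nhds 0))
    {ζ : ℂ} (hζ : ‖ζ‖ = 1) (h1 : ζ ≠ 1) (h2 : ζ ≠ -1) :
    Tendsto (fun w => u (cay w)) (𝓝[Metric.ball 0 1] ζ) (𝓝 0) := by
  have hne : 1 - ζ ≠ 0 := fun h => h1 (by linear_combination -h)
  have hne2 : 1 + ζ ≠ 0 := fun h => h2 (by linear_combination h)
  have hre : (cay ζ).re = 0 := by rw [cay_re, hζ]; simp
  have heq : cay ζ = ((cay ζ).im : ℂ) * I := by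
    apply Complex.ext <;> simp [hre]
  have him : (cay ζ).im ≠ 0 := by
    intro h
    have : cay ζ = 0 := Complex.ext hre h
    exact div_ne_zero hne2 hne this
  refine (hbdry _ him).comp ?_
  rw [← heq]
  refine tendsto_nhdsWithin_iff.2 ⟨?_, ?_⟩
  · have : ContinuousAt cay ζ := by
      unfold cay
      exact ContinuousAt.div (by fun_prop) (by fun_prop) hne
    exact this.tendsto.mono_left nhdsWithin_le_nhds
  · filter_upwards [self_mem_nhdsWithin] with w hw
    exact cay_re_pos (by simpa using hw)

lemma bdry_unif {u : ℂ → ℝ}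
    (hbdry : ∀ y : ℝ, y ≠ 0 →
      Tendsto u (𝓝[{z : ℂ | 0 < z.re}] ((y : ℂ) * Complex.I)) (nhds 0))
    (r : ℕ → ℝ) (hr0 : ∀ n, 0 < r n) (hr1 : ∀ n, r n < 1) (hr : Tendsto r atTop (𝓝 1)) :
    ∀ K ⊆ Metric.sphere (0 : ℂ) 1, IsCompact K → 1 ∉ K → -1 ∉ K → ∀ ε > 0,
      ∀ᶠ n in atTop, ∀ ζ ∈ K, u (cay (r n * ζ)) < ε := by
  intro K hKS hK h1 h2 ε hε
  have key : ∀ᶠ s : ℝ in 𝓝 (1 : ℝ), ∀ ζ ∈ K, (‖(s : ℂ) * ζ‖ < 1 → u (cay (s * ζ)) < ε) := by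
    refine hK.eventually_forall_of_forall_eventually
      (P := fun (s : ℝ) (ζ : ℂ) => ‖(s : ℂ) * ζ‖ < 1 → u (cay (s * ζ)) < ε) ?_
    intro ζ hζ
    have hn : ‖ζ‖ = 1 := by simpa using hKS hζ
    have ht := bdry_tendsto hbdry hn (fun h => h1 (h ▸ hζ)) (fun h => h2 (h ▸ hζ))
    have hev := eventually_nhdsWithin_iff.1 (ht.eventually (gt_mem_nhds hε))
    have hc : Tendsto (fun z : ℝ × ℂ => (z.1 : ℂ) * z.2) (𝓝 (1, ζ)) (𝓝 ζ) := by
      have : Continuous (fun z : ℝ × ℂ => (z.1 : ℂ) * z.2) := by fun_prop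
      simpa using this.tendsto (1, ζ)
    filter_upwards [hc.eventually hev] with z hz hz1
    exact hz (by simpa using hz1)
  filter_upwards [hr.eventually key] with n hn ζ hζ
  refine hn ζ hζ ?_
  have : ‖ζ‖ = 1 := by simpa using hKS hζ
  rw [norm_mul, this, norm_real, Real.norm_of_nonneg (hr0 n).le, mul_one]
  exact hr1 n

end HalfPlaneAux
open HalfPlaneAux

/-- **Lemma 12.** A positive harmonic function `u` in the right half-plane which extends
continuously to `iℝ \ {0}` with boundary values `0` there is of the form
`u(z) = Re(a z + b/z)` with constants `a, b ≥ 0`. -/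
theorem positive_harmonic_right_half_plane_vanishing_on_boundary
    (u : ℂ → ℝ)
    (hreg : ContDiffOn ℝ 2 u {z : ℂ | 0 < z.re})
    (hharm : ∀ z ∈ {z : ℂ | 0 < z.re},
      fderiv ℝ (fun w : ℂ => fderiv ℝ u w 1) z 1 +
        fderiv ℝ (fun w : ℂ => fderiv ℝ u w Complex.I) z Complex.I = 0)
    (hpos : ∀ z ∈ {z : ℂ | 0 < z.re}, 0 < u z)
    (hbdry : ∀ y : ℝ, y ≠ 0 →
      Tendsto u (𝓝[{z : ℂ | 0 < z.re}] ((y : ℂ) * Complex.I)) (nhds 0)) :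
    ∃ a b : ℝ, 0 ≤ a ∧ 0 ≤ b ∧
      ∀ z ∈ {z : ℂ | 0 < z.re}, u z = ((a : ℂ) * z + (b : ℂ) / z).re := by
  have hH := harm_of_hyp u hreg hharm
  set r : ℕ → ℝ := fun n => 1 - 1 / ((n : ℝ) + 2) with hrdef
  have hr0 : ∀ n, 0 < r n := by
    intro n
    have hn : (0 : ℝ) ≤ n := n.cast_nonneg
    have : 1 / ((n : ℝ) + 2) < 1 := by
      rw [div_lt_one (by positivity)]; linarith
    simp only [hrdef]; linarith
  have hr1 : ∀ n, r n < 1 := by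
    intro n
    have : 0 < 1 / ((n : ℝ) + 2) := by positivity
    simp only [hrdef]; linarith
  have hr : Tendsto r atTop (𝓝 1) := by
    have h1 : Tendsto (fun n : ℕ => 1 / ((n : ℝ) + 2)) atTop (𝓝 0) := by
      simp only [one_div]
      exact (tendsto_atTop_add_const_right _ _ tendsto_natCast_atTop_atTop).inv_tendsto_atTop
    have h2 := h1.const_sub 1
    rwa [sub_zero] at h2
  let V : ℕ → ℂ → ℝ := fun n ζ => u (cay (r n * ζ))
  have hnorm : ∀ n, ∀ ζ ∈ Metric.closedBall (0 : ℂ) 1, ‖(r n : ℂ) * ζ‖ < 1 := by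
    intro n ζ hζ
    have hζ : ‖ζ‖ ≤ 1 := by simpa using hζ
    rw [norm_mul, norm_real, Real.norm_of_nonneg (hr0 n).le]
    nlinarith [hr0 n, hr1 n]
  have hVh : ∀ n, InnerProductSpace.HarmonicOnNhd (V n) (Metric.closedBall 0 1) := by
    intro n ζ hζ
    have h1 := hnorm n ζ hζ
    refine harm_comp (g := fun x => cay (r n * x)) (hH _ (cay_re_pos h1)) ?_
    have hne : 1 - (r n : ℂ) * ζ ≠ 0 := by
      intro h
      have : (r n : ℂ) * ζ = 1 := by linear_combination -h
      simp [this] at h1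
    unfold cay
    exact AnalyticAt.fun_div (by fun_prop) (by fun_prop) hne
  have hVc : ∀ n, ContinuousOn (V n) (Metric.sphere 0 1) := fun n =>
    (hVh n).continuousOn.mono Metric.sphere_subset_closedBall
  have hV0 : ∀ n, ∀ ζ ∈ Metric.sphere (0 : ℂ) 1, 0 ≤ V n ζ := fun n ζ hζ =>
    (hpos _ (cay_re_pos (hnorm n ζ (Metric.sphere_subset_closedBall hζ)))).le
  have hVm : ∀ n, Real.circleAverage (V n) 0 1 = u 1 := by
    intro n
    rw [InnerProductSpace.HarmonicOnNhd.circleAverage_eq (by simpa using hVh n)]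
    simp [V, cay]
  have hVd := bdry_unif hbdry r hr0 hr1 hr
  -- the mass near `1`
  let m : ℕ → ℝ := fun n => Real.circleAverage (fun ζ => (1 + ζ.re) / 2 * V n ζ) 0 1
  have hqc : ∀ n, ContinuousOn (fun ζ : ℂ => (1 + ζ.re) / 2 * V n ζ) (Metric.sphere 0 1) := by
    intro n
    exact ContinuousOn.mul (by fun_prop) (hVc n)
  have hm : ∀ n, m n ∈ Icc 0 (u 1) := by
    intro n
    have hre : ∀ ζ ∈ Metric.sphere (0 : ℂ) 1, |ζ.re| ≤ 1 := by
      intro ζ hζ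
      have : ‖ζ‖ = 1 := by simpa using hζ
      exact this ▸ abs_re_le_norm ζ
    constructor
    · apply Real.circleAverage_nonneg_of_nonneg
      intro ζ hζ
      rw [abs_one] at hζ
      have := (abs_le.1 (hre ζ hζ)).1
      exact mul_nonneg (by linarith) (hV0 n ζ hζ)
    · rw [← hVm n]
      apply Real.circleAverage_mono ((hqc n).circleIntegrable zero_le_one)
        ((hVc n).circleIntegrable zero_le_one)
      intro ζ hζ
      rw [abs_one] at hζ
      have := (abs_le.1 (hre ζ hζ)).2
      exact mul_le_of_le_one_left (hV0 n ζ hζ) (by linarith)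
  obtain ⟨a, ha, φ, hφ, hlim⟩ := isCompact_Icc.tendsto_subseq hm
  refine ⟨a, u 1 - a, ha.1, by linarith [ha.2], ?_⟩
  intro z hz
  have hz : 0 < z.re := hz
  have hz1 : z + 1 ≠ 0 := by
    intro h
    have := congrArg Complex.re h
    simp at this
    linarith
  have hz0 : z ≠ 0 := by
    rintro rfl
    simp at hz
  set w : ℂ := (z - 1) / (z + 1) with hwdef
  have hcw : cay w = z := by
    rw [cay, hwdef]
    have : 1 - (z - 1) / (z + 1) ≠ 0 := by
      rw [one_sub_div hz1]
      apply div_ne_zero _ hz1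
      ring_nf
      norm_num
    field_simp
    ring
  have hw1 : 1 - w ≠ 0 := by
    intro h
    rw [cay, h, div_zero] at hcw
    exact hz0 hcw.symm
  have hw2 : 1 + w ≠ 0 := by
    intro h
    rw [cay, h, zero_div] at hcw
    exact hz0 hcw.symm
  have hw : ‖w‖ < 1 := by
    have h := cay_re w
    rw [hcw] at h
    by_contra! hge
    have : (1 - ‖w‖ ^ 2) / ‖1 - w‖ ^ 2 ≤ 0 :=
      div_nonpos_of_nonpos_of_nonneg (by nlinarith) (by positivity)
    linarith
  have hwb : w ∈ Metric.ball (0 : ℂ) 1 := by simpa using hw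
  let P : ℂ → ℝ := poissonKernel 0 w
  have hPc : ContinuousOn P (Metric.sphere 0 1) := by
    have h := continuousOn_herglotzRieszKernel_sphere hwb
    rw [abs_one] at h
    simp only [P, poissonKernel_eq_re_herglotzRieszKernel]
    exact continuous_re.comp_continuousOn h
  have hP1 : P 1 = z.re := by
    simp only [P, poissonKernel_eq_re_herglotzRieszKernel, Function.comp, herglotzRieszKernel_def,
      sub_zero]
    rw [← hcw, cay]
  have hP2 : P (-1) = (1 / z).re := by
    simp only [P, poissonKernel_eq_re_herglotzRieszKernel, Function.comp, herglotzRieszKernel_def,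
      sub_zero]
    rw [← hcw, cay, one_div_div]
    congr 1
    rw [div_eq_div_iff (by intro h; exact hw2 (by linear_combination -h)) hw2]
    ring
  let E : ℂ → ℝ := fun ζ => P ζ - (P 1 * ((1 + ζ.re) / 2) + P (-1) * ((1 - ζ.re) / 2))
  have hEc : ContinuousOn E (Metric.sphere 0 1) := hPc.sub (by fun_prop)
  have hdec := decay (l := atTop) V (u 1) E hV0 hVc hVm hEc (by simp [E])
    (by simp [E]) hVd
  have hid : ∀ n, V n w = Real.circleAverage (fun ζ => E ζ * V n ζ) 0 1 +
      (P 1 - P (-1)) * m n + P (-1) * u 1 := by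
    intro n
    rw [← (hVh n).circleAverage_poissonKernel_smul hwb, ← hVm n]
    have e : poissonKernel 0 w • V n = fun ζ => (E ζ * V n ζ +
        (P 1 - P (-1)) • ((1 + ζ.re) / 2 * V n ζ)) + P (-1) • V n ζ := by
      funext ζ
      simp only [Pi.smul_apply', smul_eq_mul, E, P]
      ring
    have i1 := (hEc.mul (hVc n)).circleIntegrable zero_le_one
    have i2 := ((hqc n).const_smul (P 1 - P (-1))).circleIntegrable zero_le_one
    have i3 := ((hVc n).const_smul (P (-1))).circleIntegrable zero_le_one
    rw [e]
    refine (Real.circleAverage_add (i1.add i2) i3).trans ?_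
    congr 1
    · refine (Real.circleAverage_add i1 i2).trans ?_
      congr 1
      exact Real.circleAverage_smul
    · exact Real.circleAverage_smul
  have hL : Tendsto (fun n => V (φ n) w) atTop (𝓝 (u z)) := by
    have hcont : ContinuousAt (fun x : ℂ => u (cay x)) w := by
      refine ContinuousAt.comp (g := u) ?_ ?_
      · rw [hcw]
        exact (hH z hz).1.continuousAt
      · unfold cay
        exact ContinuousAt.div (by fun_prop) (by fun_prop) hw1
    have ht : Tendsto (fun n => (r (φ n) : ℂ) * w) atTop (𝓝 w) := by
      have h1 : Tendsto (fun n => (r (φ n) : ℂ)) atTop (𝓝 ((1 : ℝ) : ℂ)) :=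
        (continuous_ofReal.tendsto 1).comp (hr.comp hφ.tendsto_atTop)
      simpa using h1.mul_const w
    have := hcont.tendsto.comp ht
    rwa [hcw] at this
  have hR : Tendsto (fun n => V (φ n) w) atTop
      (𝓝 (0 + (P 1 - P (-1)) * a + P (-1) * u 1)) := by
    simp only [hid]
    exact ((hdec.comp hφ.tendsto_atTop).add (hlim.const_mul _)).add_const _
  rw [tendsto_nhds_unique hL hR, hP1, hP2, add_re, re_ofReal_mul, div_eq_mul_one_div ((u 1 - a : ℝ) : ℂ) z,
    re_ofReal_mul]
  ring
end
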